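/- For every natural number N and all indices γ, μ, ν in Fin n, the following identity holds in the polynomial ring k[X_1,…,X_n]: ∑_{p+q=N+1} ((−1)^p B_p/p!)·((−1)^q B_q/q!) · ∑_ρ [ δ_ρ((𝒞^p)^γ_μ) · (𝒞^q)^ρ_ν − δ_ρ((𝒞^p)^γ_ν) · (𝒞^q)^ρ_μ ] = ((−1)^N B_N/N!) · ∑_σ C^σ_{μν} · (𝒞^N)^γ_σ, where the outer sum is over pairs of natural numbers (p,q) with p+q = N+1. (This is the degree-N homogeneous component of the power-series identity (δ_ρ φ^γ_μ) φ^ρ_ν − (δ_ρ φ^γ_ν) φ^ρ_μ = C^σ_{μν} φ^γ_σ, which expresses that the elements x̂_μ = x_σ φ^σ_μ of the completed Weyl algebra satisfy the Lie algebra relations [x̂_μ, x̂_ν] = C^λ_{μν} x̂_λ.) -/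

import Mathlib

open Finset MvPolynomial

section PowerSeriesIdentity

variable {A : Type*} [CommRing A] [Algebra ℚ A]

theorem rescale_exp_sub_one_ne_zero {z : A} (hz : z ≠ 0) :
    PowerSeries.rescale z (PowerSeries.exp A) - 1 ≠ 0 := by
  intro h
  apply hz
  simpa [PowerSeries.coeff_rescale, PowerSeries.coeff_exp, PowerSeries.coeff_one] using
    congrArg (PowerSeries.coeff 1) h

theorem rescale_bernoulli'PowerSeries_mul (z : A) :
    PowerSeries.rescale z (bernoulli'PowerSeries A) *
        (PowerSeries.rescale z (PowerSeries.exp A) - 1) =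
      PowerSeries.C z * PowerSeries.X * PowerSeries.rescale z (PowerSeries.exp A) := by
  simpa [PowerSeries.rescale_X] using
    congrArg (PowerSeries.rescale z) (bernoulli'PowerSeries_mul_exp_sub_one A)

theorem coeff_rescale_bernoulli'PowerSeries (z : A) (p : ℕ) :
    PowerSeries.coeff p (PowerSeries.rescale z (bernoulli'PowerSeries A)) =
      z ^ p * algebraMap ℚ A ((-1) ^ p * bernoulli p / p.factorial) := by
  simp [PowerSeries.coeff_rescale, bernoulli'PowerSeries, bernoulli'_eq_bernoulli]

variable [IsDomain A]

/-- The addition formula of `t / (1 - exp (-t))`. -/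
theorem rescale_bernoulli'PowerSeries_add {x y : A} (hx : x ≠ 0) (hy : y ≠ 0)
    (hxy : x + y ≠ 0) :
    PowerSeries.C x * ((PowerSeries.rescale (x + y) (bernoulli'PowerSeries A) -
          PowerSeries.rescale x (bernoulli'PowerSeries A)) *
        PowerSeries.rescale y (bernoulli'PowerSeries A)) +
      PowerSeries.C y * ((PowerSeries.rescale (x + y) (bernoulli'PowerSeries A) -
          PowerSeries.rescale y (bernoulli'PowerSeries A)) *
        PowerSeries.rescale x (bernoulli'PowerSeries A)) =
      PowerSeries.C (x * y) *
        (PowerSeries.rescale (x + y) (bernoulli'PowerSeries A) * PowerSeries.X) := by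
  have h₁ := rescale_bernoulli'PowerSeries_mul x
  have h₂ := rescale_bernoulli'PowerSeries_mul y
  have h₃ := rescale_bernoulli'PowerSeries_mul (x + y)
  have n₁ := rescale_exp_sub_one_ne_zero hx
  have n₂ := rescale_exp_sub_one_ne_zero hy
  have n₃ := rescale_exp_sub_one_ne_zero hxy
  rw [← PowerSeries.exp_mul_exp_eq_exp_add] at h₃ n₃
  rw [map_add] at h₃
  rw [map_mul]
  generalize PowerSeries.rescale (x + y) (bernoulli'PowerSeries A) = F at *
  generalize PowerSeries.rescale x (bernoulli'PowerSeries A) = G at *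
  generalize PowerSeries.rescale y (bernoulli'PowerSeries A) = H at *
  generalize PowerSeries.rescale x (PowerSeries.exp A) = a at *
  generalize PowerSeries.rescale y (PowerSeries.exp A) = b at *
  generalize (PowerSeries.X : PowerSeries A) = t at *
  generalize PowerSeries.C x = u at *
  generalize PowerSeries.C y = v at *
  refine mul_right_cancel₀ (mul_ne_zero (mul_ne_zero n₁ n₂) n₃) ?_
  have e : (u * ((F - G) * H) + v * ((F - H) * G)) * ((a - 1) * (b - 1) * (a * b - 1)) =
      u * (F * (a * b - 1)) * (H * (b - 1)) * (a - 1)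
      + v * (F * (a * b - 1)) * (G * (a - 1)) * (b - 1)
      - (u + v) * (G * (a - 1)) * (H * (b - 1)) * (a * b - 1) := by ring
  have e' : u * v * (F * t) * ((a - 1) * (b - 1) * (a * b - 1)) =
      u * v * t * (F * (a * b - 1)) * ((a - 1) * (b - 1)) := by ring
  rw [e, e', h₁, h₂, h₃]
  ring

theorem sum_antidiagonal_bernoulli_mul_geom_sum {x y : A} (hx : x ≠ 0) (hy : y ≠ 0)
    (hxy : x + y ≠ 0) (N : ℕ) :
    ∑ pq ∈ antidiagonal (N + 1),
        algebraMap ℚ A (((-1) ^ pq.1 * bernoulli pq.1 / pq.1.factorial) *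
            ((-1) ^ pq.2 * bernoulli pq.2 / pq.2.factorial)) *
          (∑ i ∈ range pq.1, (x + y) ^ i * (x ^ (pq.1 - 1 - i) * y ^ pq.2) +
            ∑ i ∈ range pq.1, (x + y) ^ i * (x ^ pq.2 * y ^ (pq.1 - 1 - i))) =
      algebraMap ℚ A ((-1) ^ N * bernoulli N / N.factorial) * (x + y) ^ N := by
  have key := congrArg (PowerSeries.coeff (N + 1))
    (rescale_bernoulli'PowerSeries_add hx hy hxy)
  simp only [map_add, PowerSeries.coeff_C_mul, PowerSeries.coeff_succ_mul_X] at key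
  simp only [PowerSeries.coeff_mul, map_sub, coeff_rescale_bernoulli'PowerSeries] at key
  refine mul_left_cancel₀ (mul_ne_zero hx hy) ?_
  rw [mul_comm (algebraMap ℚ A _) ((x + y) ^ N), ← key]
  simp only [mul_sum _ _ (x * y), mul_sum _ _ x, mul_sum _ _ y]
  rw [← sum_add_distrib]
  refine sum_congr rfl fun pq _ => ?_
  have g₁ := (Commute.all (x + y) x).geom_sum₂_mul pq.1
  have g₂ := (Commute.all (x + y) y).geom_sum₂_mul pq.1
  rw [add_sub_cancel_left] at g₁
  rw [add_sub_cancel_right] at g₂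
  have s₁ : ∑ i ∈ range pq.1, (x + y) ^ i * (x ^ (pq.1 - 1 - i) * y ^ pq.2) =
      (∑ i ∈ range pq.1, (x + y) ^ i * x ^ (pq.1 - 1 - i)) * y ^ pq.2 := by
    rw [sum_mul]
    exact sum_congr rfl fun _ _ => by ring
  have s₂ : ∑ i ∈ range pq.1, (x + y) ^ i * (x ^ pq.2 * y ^ (pq.1 - 1 - i)) =
      (∑ i ∈ range pq.1, (x + y) ^ i * y ^ (pq.1 - 1 - i)) * x ^ pq.2 := by
    rw [sum_mul]
    exact sum_congr rfl fun _ _ => by ring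
  rw [s₁, s₂, ← sub_mul, ← sub_mul, ← g₁, ← g₂, map_mul]
  ring

end PowerSeriesIdentity

section Bilinear

variable {R V : Type*} [CommRing R] [AddCommGroup V] [Module R V] [Module ℚ V]
  (T : Module.End R V) (B : V →ₗ[R] V →ₗ[R] V) (a b : V)

/-- The `ℚ`-linear map on polynomials in two variables sending `X₀ ^ i * X₁ ^ j` to
`B (T ^ i a) (T ^ j b)`. -/
noncomputable def bilinearEval : MvPolynomial (Fin 2) ℚ →ₗ[ℚ] V :=
  (basisMonomials (Fin 2) ℚ).constr ℚ fun m => B ((T ^ m 0) a) ((T ^ m 1) b)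

theorem bilinearEval_monomial (m : Fin 2 →₀ ℕ) (r : ℚ) :
    bilinearEval T B a b (monomial m r) = r • B ((T ^ m 0) a) ((T ^ m 1) b) := by
  have h := (basisMonomials (Fin 2) ℚ).constr_basis ℚ
    (fun m => B ((T ^ m 0) a) ((T ^ m 1) b)) m
  rw [coe_basisMonomials] at h
  rw [bilinearEval, ← h, ← map_smul, smul_monomial, smul_eq_mul, mul_one]

theorem bilinearEval_X_pow_mul_X_pow (i j : ℕ) :
    bilinearEval T B a b (X 0 ^ i * X 1 ^ j) = B ((T ^ i) a) ((T ^ j) b) := by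
  rw [X_pow_eq_monomial, X_pow_eq_monomial, monomial_mul, bilinearEval_monomial]
  simp

variable {T B}

theorem bilinearEval_X_add_X_mul (hT : ∀ u v, T (B u v) = B (T u) v + B u (T v))
    (P : MvPolynomial (Fin 2) ℚ) :
    bilinearEval T B a b ((X 0 + X 1) * P) = T (bilinearEval T B a b P) := by
  induction P using MvPolynomial.induction_on' with
  | monomial u r =>
    rw [add_mul, map_add, X, X, monomial_mul, monomial_mul]
    simp only [bilinearEval_monomial, map_rat_smul, hT]
    simp [pow_add, ← smul_add]
  | add p q hp hq => rw [mul_add, map_add, map_add, hp, hq, map_add]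

theorem bilinearEval_X_add_X_pow_mul (hT : ∀ u v, T (B u v) = B (T u) v + B u (T v))
    (i : ℕ) (P : MvPolynomial (Fin 2) ℚ) :
    bilinearEval T B a b ((X 0 + X 1) ^ i * P) = (T ^ i) (bilinearEval T B a b P) := by
  induction i with
  | zero => simp
  | succ i ih =>
    rw [pow_succ', mul_assoc, bilinearEval_X_add_X_mul a b hT, ih, pow_succ', Module.End.mul_apply]

theorem sum_antidiagonal_bernoulli_smul (hT : ∀ u v, T (B u v) = B (T u) v + B u (T v))
    (N : ℕ) :
    ∑ pq ∈ antidiagonal (N + 1),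
        (((-1) ^ pq.1 * bernoulli pq.1 / pq.1.factorial) *
            ((-1) ^ pq.2 * bernoulli pq.2 / pq.2.factorial) : ℚ) •
          (∑ i ∈ range pq.1, (T ^ i) (B ((T ^ (pq.1 - 1 - i)) a) ((T ^ pq.2) b)) +
            ∑ i ∈ range pq.1, (T ^ i) (B ((T ^ pq.2) a) ((T ^ (pq.1 - 1 - i)) b))) =
      ((-1) ^ N * bernoulli N / N.factorial : ℚ) • (T ^ N) (B a b) := by
  have hne : (X 0 + X 1 : MvPolynomial (Fin 2) ℚ) ≠ 0 := fun h => by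
    simpa using congrArg (MvPolynomial.eval fun _ => (1 : ℚ)) h
  have h := congrArg (bilinearEval T B a b) (sum_antidiagonal_bernoulli_mul_geom_sum
    (X_ne_zero (R := ℚ) (0 : Fin 2)) (X_ne_zero (1 : Fin 2)) hne N)
  have h₀ : bilinearEval T B a b 1 = B a b := by
    simpa using bilinearEval_X_pow_mul_X_pow T B a b 0 0
  rw [← mul_one ((X 0 + X 1) ^ N)] at h
  simpa only [← Algebra.smul_def, map_sum, map_smul, map_add,
    bilinearEval_X_add_X_pow_mul a b hT, bilinearEval_X_pow_mul_X_pow, h₀] using h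

end Bilinear

theorem Derivation.map_matrix_pow {S R ι : Type*} [CommRing S] [CommRing R] [Algebra S R]
    [Fintype ι] [DecidableEq ι] (D : Derivation S R R) (M : Matrix ι ι R) (p : ℕ) :
    (M ^ p).map D = ∑ i ∈ range p, M ^ i * (M.map D * M ^ (p - 1 - i)) := by
  have hmul (P Q : Matrix ι ι R) : (P * Q).map D = P * Q.map D + P.map D * Q := by
    ext i j
    simp [Matrix.mul_apply, sum_add_distrib, mul_comm]
  induction p with
  | zero =>
    ext i j
    by_cases h : i = j <;> simp [h]
  | succ p ih =>
    rw [pow_succ, hmul, ih, sum_range_succ, sum_mul, add_comm]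
    congr 1
    · refine sum_congr rfl fun i hi => ?_
      have hi' := mem_range.mp hi
      rw [show p + 1 - 1 - i = p - 1 - i + 1 by omega, pow_succ]
      simp only [mul_assoc]
    · simp

section StructureConstants

variable {R ι : Type*} [CommRing R] [Fintype ι] (c : ι → ι → ι → R)

/-- The bilinear bracket on `ι → R` with structure constants `c`, the first index being the
upper one. -/
noncomputable def structureBracket : (ι → R) →ₗ[R] (ι → R) →ₗ[R] (ι → R) :=
  (Pi.basisFun R ι).constr R fun μ => (Pi.basisFun R ι).constr R fun ν => fun l => c l μ ν

theorem structureBracket_single [DecidableEq ι] (μ ν : ι) :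
    structureBracket c (Pi.single μ 1) (Pi.single ν 1) = fun l => c l μ ν := by
  simp only [structureBracket, ← Pi.basisFun_apply, Module.Basis.constr_basis]

theorem structureBracket_apply (u v : ι → R) (l : ι) :
    structureBracket c u v l = ∑ μ, ∑ ν, c l μ ν * u μ * v ν := by
  simp only [structureBracket, Module.Basis.constr_apply_fintype, Pi.basisFun_equivFun,
    LinearEquiv.refl_apply, LinearMap.sum_apply, LinearMap.smul_apply, Finset.sum_apply,
    Pi.smul_apply, smul_eq_mul, mul_sum]
  exact sum_congr rfl fun _ _ => sum_congr rfl fun _ _ => by ring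

variable {c}

theorem structureBracket_swap (hanti : ∀ l μ ν, c l μ ν = - c l ν μ) (u v : ι → R) :
    structureBracket c u v = - structureBracket c v u := by
  ext l
  rw [Pi.neg_apply, structureBracket_apply, structureBracket_apply, sum_comm, ← sum_neg_distrib]
  refine sum_congr rfl fun μ _ => ?_
  rw [← sum_neg_distrib]
  exact sum_congr rfl fun ν _ => by rw [hanti l ν μ]; ring

theorem structureBracket_leibniz [DecidableEq ι] (hanti : ∀ l μ ν, c l μ ν = - c l ν μ)
    (hjac : ∀ μ ν τ σ, ∑ ρ, (c ρ μ ν * c σ ρ τ + c ρ ν τ * c σ ρ μ + c ρ τ μ * c σ ρ ν) = 0)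
    (u v w : ι → R) :
    structureBracket c (structureBracket c u v) w =
      structureBracket c (structureBracket c u w) v +
        structureBracket c u (structureBracket c v w) := by
  have hbasis (μ ν τ : ι) :
      structureBracket c (structureBracket c (Pi.single μ 1) (Pi.single ν 1)) (Pi.single τ 1) =
        structureBracket c (structureBracket c (Pi.single μ 1) (Pi.single τ 1))
            (Pi.single ν 1) +
          structureBracket c (Pi.single μ 1)
            (structureBracket c (Pi.single ν 1) (Pi.single τ 1)) := by
    ext σ
    simp only [structureBracket_single, Pi.add_apply]
    simp only [structureBracket_apply, Pi.single_apply, mul_ite, mul_one, mul_zero, ite_mul,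
      zero_mul, sum_ite_eq', mem_univ, if_true, sum_ite_irrel, sum_const_zero]
    rw [← sub_eq_zero, ← sum_add_distrib, ← sum_sub_distrib, ← hjac μ ν τ σ]
    exact sum_congr rfl fun ρ _ => by rw [hanti σ μ ρ, hanti ρ μ τ]; ring
  have h₁ (μ ν : ι) : structureBracket c
      (structureBracket c (Pi.single μ 1) (Pi.single ν 1)) =
        (structureBracket c).flip (Pi.single ν 1) ∘ₗ structureBracket c (Pi.single μ 1) +
          structureBracket c (Pi.single μ 1) ∘ₗ structureBracket c (Pi.single ν 1) :=
    (Pi.basisFun R ι).ext fun τ => by simpa using hbasis μ ν τ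
  have h₂ (μ : ι) (w : ι → R) : (structureBracket c).flip w ∘ₗ
      structureBracket c (Pi.single μ 1) =
        structureBracket c (structureBracket c (Pi.single μ 1) w) +
          structureBracket c (Pi.single μ 1) ∘ₗ (structureBracket c).flip w :=
    (Pi.basisFun R ι).ext fun ν => by simpa using LinearMap.congr_fun (h₁ μ ν) w
  have h₃ (v w : ι → R) : (structureBracket c).flip w ∘ₗ (structureBracket c).flip v =
      (structureBracket c).flip v ∘ₗ (structureBracket c).flip w +
        (structureBracket c).flip (structureBracket c v w) :=
    (Pi.basisFun R ι).ext fun μ => by simpa using LinearMap.congr_fun (h₂ μ w) v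
  simpa using LinearMap.congr_fun (h₃ v w) u

end StructureConstants

theorem sum_pderiv_matrix_pow_mul {k ι : Type*} [CommRing k] [Fintype ι] [DecidableEq ι]
    {c : ι → ι → ι → k} {M : Matrix ι ι (MvPolynomial ι k)}
    (hM : ∀ α β, M α β = ∑ g, MvPolynomial.C (c α β g) * X g)
    (v : ι → MvPolynomial ι k) (p : ℕ) (γ μ : ι) :
    ∑ ρ, pderiv ρ ((M ^ p) γ μ) * v ρ =
      (∑ i ∈ range p, (M.toLin' ^ i) (structureBracket (fun l a b => MvPolynomial.C (c l a b))
        ((M.toLin' ^ (p - 1 - i)) (Pi.single μ 1)) v)) γ := by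
  obtain ⟨D, hD⟩ : ∃ D : Derivation k (MvPolynomial ι k) (MvPolynomial ι k),
      ∀ f, D f = ∑ ρ, pderiv ρ f * v ρ := by
    refine ⟨∑ ρ, v ρ • pderiv ρ, fun f => ?_⟩
    rw [← Derivation.coeFnAddMonoidHom_apply, map_sum, Finset.sum_apply]
    simp [mul_comm]
  have hMD (u : ι → MvPolynomial ι k) : (M.map D).mulVec u =
      structureBracket (fun l a b => MvPolynomial.C (c l a b)) u v := by
    ext1 α
    rw [structureBracket_apply, Matrix.mulVec, dotProduct]
    refine sum_congr rfl fun β _ => ?_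
    rw [Matrix.map_apply, hD, sum_mul]
    refine sum_congr rfl fun ρ _ => ?_
    rw [hM, map_sum]
    simp [pderiv_X, Pi.single_apply]
    ring
  have h := congrFun (congrFun (Derivation.map_matrix_pow D M p) γ) μ
  rw [Matrix.map_apply, hD] at h
  rw [h, Matrix.sum_apply, Finset.sum_apply]
  refine sum_congr rfl fun i _ => ?_
  rw [← Matrix.toLin'_pow, ← Matrix.toLin'_pow, Matrix.toLin'_apply, Matrix.toLin'_apply, ← hMD,
    Matrix.mulVec_mulVec, Matrix.mulVec_mulVec, Matrix.mulVec_single_one, Matrix.col_apply,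
    mul_assoc]

/-- Degree-`N` homogeneous component of
`(δ_ρ φ^γ_μ) φ^ρ_ν − (δ_ρ φ^γ_ν) φ^ρ_μ = C^σ_{μν} φ^γ_σ`,
where `φ = ∑_p ((−1)^p B_p/p!) 𝒞^p`. -/
theorem statement3 (k : Type*) [Field k] [CharZero k] (n : ℕ)
    (C : Fin n → Fin n → Fin n → k)
    (hanti : ∀ l μ ν, C l μ ν = - C l ν μ)
    (hjac : ∀ μ ν τ σ, ∑ ρ, (C ρ μ ν * C σ ρ τ + C ρ ν τ * C σ ρ μ + C ρ τ μ * C σ ρ ν) = 0)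
    (𝒞 : Matrix (Fin n) (Fin n) (MvPolynomial (Fin n) k))
    (h𝒞 : ∀ α β, 𝒞 α β = ∑ g, MvPolynomial.C (C α β g) * X g)
    (N : ℕ) (γ μ ν : Fin n) :
    ∑ pq ∈ antidiagonal (N + 1),
        MvPolynomial.C ((((-1) ^ pq.1 * bernoulli pq.1 / pq.1.factorial) *
            ((-1) ^ pq.2 * bernoulli pq.2 / pq.2.factorial) : ℚ) : k) *
          ∑ ρ, (pderiv ρ ((𝒞 ^ pq.1) γ μ) * (𝒞 ^ pq.2) ρ ν
            - pderiv ρ ((𝒞 ^ pq.1) γ ν) * (𝒞 ^ pq.2) ρ μ)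
      = MvPolynomial.C ((((-1) ^ N * bernoulli N / N.factorial) : ℚ) : k) *
          ∑ σ, MvPolynomial.C (C σ μ ν) * (𝒞 ^ N) γ σ := by
  set B := structureBracket (fun l a b => MvPolynomial.C (σ := Fin n) (C l a b)) with hB
  have hanti' (l a b : Fin n) :
      MvPolynomial.C (σ := Fin n) (C l a b) = - MvPolynomial.C (C l b a) := by
    rw [hanti, map_neg]
  have hjac' (μ ν τ σ : Fin n) := by
    simpa only [map_sum, map_add, map_mul, map_zero] using
      congrArg (MvPolynomial.C (σ := Fin n)) (hjac μ ν τ σ)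
  have hTX (u : Fin n → MvPolynomial (Fin n) k) : 𝒞.toLin' u = B u X := by
    ext1 α
    rw [Matrix.toLin'_apply, hB, structureBracket_apply, Matrix.mulVec, dotProduct]
    refine sum_congr rfl fun β _ => ?_
    rw [h𝒞, sum_mul]
    exact sum_congr rfl fun g _ => by ring
  have hT (u v) : 𝒞.toLin' (B u v) = B (𝒞.toLin' u) v + B u (𝒞.toLin' v) := by
    simp only [hTX]
    exact structureBracket_leibniz hanti' hjac' u v X
  have hcol (q : ℕ) (σ ρ : Fin n) :
      (𝒞 ^ q) ρ σ = (𝒞.toLin' ^ q) (Pi.single σ 1) ρ := by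
    rw [← Matrix.toLin'_pow, Matrix.toLin'_apply, Matrix.mulVec_single_one, Matrix.col_apply]
  have hC (r : ℚ) (f : MvPolynomial (Fin n) k) :
      MvPolynomial.C (r : k) * f = r • f := by
    rw [Algebra.smul_def, MvPolynomial.algebraMap_apply, eq_ratCast]
  have h := congrFun
    (sum_antidiagonal_bernoulli_smul (Pi.single μ 1) (Pi.single ν 1) hT N) γ
  simp only [hC]
  rw [Finset.sum_apply] at h
  refine Eq.trans (sum_congr rfl fun pq _ => ?_) (h.trans ?_)
  · rw [Pi.smul_apply, sum_sub_distrib]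
    simp only [hcol pq.2]
    rw [sum_pderiv_matrix_pow_mul h𝒞, sum_pderiv_matrix_pow_mul h𝒞, ← hB, Pi.add_apply,
      sub_eq_add_neg]
    congr 2
    rw [← Pi.neg_apply, ← sum_neg_distrib]
    refine congrFun (sum_congr rfl fun i _ => ?_) γ
    rw [← map_neg, hB, ← structureBracket_swap hanti']
  · rw [Pi.smul_apply, hB, structureBracket_single, ← Matrix.toLin'_pow, Matrix.toLin'_apply,
      Matrix.mulVec, dotProduct]
    simp only [mul_comm]
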